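/- arXiv:1712.08358 — 3 statements merged into one kernel-verified Lean document; each statement's English description precedes it below -/
import Mathlib

section
/- Let q ≥ 1, α ∈ ℝ, n ∈ ℕ₀, and (s_j)_{j=0}^{2n+1} ∈ K≥,e_{α,q,2n+1}, and let Θ_{n,α}, Θ̃_{n,α} : ℂ → ℂ^{2q×2q} be the matrix polynomials defined in the context. Then: (a) for every x ∈ ℝ, Θ_{n,α}(x)·J̃_q·Θ_{n,α}(x)* = J̃_q and Θ̃_{n,α}(x)·J̃_q·Θ̃_{n,α}(x)* = J̃_q; (b) for every z ∈ ℂ the matrices Θ_{n,α}(z) and Θ̃_{n,α}(z) are invertible, and Θ_{n,α}(z)^{−1} = J̃_q·Θ_{n,α}(conj(z))*·J̃_q as well as Θ̃_{n,α}(z)^{−1} = J̃_q·Θ̃_{n,α}(conj(z))*·J̃_q. -/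
open Matrix ComplexConjugate
open scoped ComplexOrder

noncomputable section

/-- The block Hankel matrix `H_n = [s_{j+k}]_{j,k=0}^n`. -/
def hank (q n : ℕ) (s : ℕ → Matrix (Fin q) (Fin q) ℂ) :
    Matrix (Fin (n + 1) × Fin q) (Fin (n + 1) × Fin q) ℂ :=
  Matrix.of fun j k => s (j.1.val + k.1.val) j.2 k.2

/-- The right-sided `α`-shifted sequence `s_{α▷j} = -α·s_j + s_{j+1}`. -/
def sShift {q : ℕ} (α : ℝ) (s : ℕ → Matrix (Fin q) (Fin q) ℂ) :
    ℕ → Matrix (Fin q) (Fin q) ℂ :=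
  fun j => (-(α : ℂ)) • s j + s (j + 1)

/-- The block shift `T_{q,n} = [δ_{j,k+1}·I_q]_{j,k=0}^n`. -/
def bshift (q n : ℕ) : Matrix (Fin (n + 1) × Fin q) (Fin (n + 1) × Fin q) ℂ :=
  Matrix.of fun j k => if j.1.val = k.1.val + 1 ∧ j.2 = k.2 then (1 : ℂ) else 0

/-- `v_{q,n} = col(δ_{j,0}·I_q)_{j=0}^n`. -/
def vq (q n : ℕ) : Matrix (Fin (n + 1) × Fin q) (Fin q) ℂ :=
  Matrix.of fun j b => if j.1.val = 0 ∧ j.2 = b then (1 : ℂ) else 0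

/-- `u_n = -col(s_{j-1})_{j=0}^n` with `s_{-1} = 0`. -/
def uq (q n : ℕ) (s : ℕ → Matrix (Fin q) (Fin q) ℂ) :
    Matrix (Fin (n + 1) × Fin q) (Fin q) ℂ :=
  Matrix.of fun j b => if j.1.val = 0 then 0 else -s (j.1.val - 1) j.2 b

/-- `y_{0,n} = col(s_j)_{j=0}^n`. -/
def yq (q n : ℕ) (s : ℕ → Matrix (Fin q) (Fin q) ℂ) :
    Matrix (Fin (n + 1) × Fin q) (Fin q) ℂ :=
  Matrix.of fun j b => s j.1.val j.2 b

/-- `R_T(z) = (I - z·T_{q,n})⁻¹`. -/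
def RT (q n : ℕ) (z : ℂ) : Matrix (Fin (n + 1) × Fin q) (Fin (n + 1) × Fin q) ℂ :=
  (1 - z • bshift q n)⁻¹

/-- `R_{T*}(z) = (I - z·T_{q,n}*)⁻¹`. -/
def RTs (q n : ℕ) (z : ℂ) : Matrix (Fin (n + 1) × Fin q) (Fin (n + 1) × Fin q) ℂ :=
  (1 - z • (bshift q n)ᴴ)⁻¹

open scoped Classical in
/-- The Moore–Penrose inverse of a complex matrix (it exists and is unique,
so the `dite` below always takes its first branch and picks it out). -/
def mp {m n : Type*} [Fintype m] [Fintype n] (A : Matrix m n ℂ) : Matrix n m ℂ :=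
  if h : ∃ X : Matrix n m ℂ,
      A * X * A = A ∧ X * A * X = X ∧ (A * X)ᴴ = A * X ∧ (X * A)ᴴ = X * A
  then h.choose else 0

/-- The Schur complements `L_0 = s_0` and
`L_j = s_{2j} - z_{j,2j-1}·(H_{j-1})^†·y_{j,2j-1}` for `j ≥ 1`. -/
def LS (q : ℕ) (s : ℕ → Matrix (Fin q) (Fin q) ℂ) : ℕ → Matrix (Fin q) (Fin q) ℂ
  | 0 => s 0
  | n + 1 =>
      s (2 * (n + 1)) -
        (Matrix.of fun (a : Fin q) (j : Fin (n + 1) × Fin q) => s ((n + 1) + j.1.val) a j.2) *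
          mp (hank q n s) *
          (Matrix.of fun (j : Fin (n + 1) × Fin q) (b : Fin q) => s ((n + 1) + j.1.val) j.2 b)

/-- The block diagonal matrix `diag(L_0, …, L_n)`. -/
def Ldiag (q n : ℕ) (s : ℕ → Matrix (Fin q) (Fin q) ℂ) :
    Matrix (Fin (n + 1) × Fin q) (Fin (n + 1) × Fin q) ℂ :=
  Matrix.of fun j k => if j.1 = k.1 then LS q s j.1.val j.2 k.2 else 0

/-- The subspace `D_n = range(diag(L_0, …, L_n)) ⊆ ℂ^{(n+1)q}`. -/
def Dsub (q n : ℕ) (s : ℕ → Matrix (Fin q) (Fin q) ℂ) :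
    Submodule ℂ (Fin (n + 1) × Fin q → ℂ) :=
  LinearMap.range (Matrix.mulVecLin (Ldiag q n s))

/-- `V_{q,n+1} = [δ_{j,k}·I_q]`, embedding `ℂ^{(n+1)q}` into the first `n+1` block
components of `ℂ^{(n+2)q}` (defined here with `n+1` block columns). -/
def embV (q n : ℕ) : Matrix (Fin (n + 1) × Fin q) (Fin n × Fin q) ℂ :=
  Matrix.of fun j k => if j.1.val = k.1.val ∧ j.2 = k.2 then (1 : ℂ) else 0

/-- `𝔙_{q,n+1} = [δ_{j,k+1}·I_q]`, embedding `ℂ^{(n+1)q}` into the last `n+1` block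
components of `ℂ^{(n+2)q}` (defined here with `n+1` block columns). -/
def embW (q n : ℕ) : Matrix (Fin (n + 1) × Fin q) (Fin n × Fin q) ℂ :=
  Matrix.of fun j k => if j.1.val = k.1.val + 1 ∧ j.2 = k.2 then (1 : ℂ) else 0

end

/-- `G` is the generalized inverse `H_D^⊐` of a Hermitian matrix `H` associated with a
subspace `D`: `HGH = H`, `GHG = G`, `range G = D` and `ker G = D^⊥`. -/
def IsRGI {ι : Type*} [Fintype ι] (H G : Matrix ι ι ℂ) (D : Submodule ℂ (ι → ℂ)) : Prop :=
  H * G * H = H ∧ G * H * G = G ∧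
    LinearMap.range (Matrix.mulVecLin G) = D ∧
    ∀ x : ι → ℂ, Matrix.mulVec G x = 0 ↔ ∀ y ∈ D, dotProduct (star y) x = 0

noncomputable section

/-- The signature matrix `J̃_q = [[0, -i·I_q], [i·I_q, 0]]`. -/
def Jmat (q : ℕ) : Matrix (Fin q ⊕ Fin q) (Fin q ⊕ Fin q) ℂ :=
  Matrix.fromBlocks 0 ((-Complex.I) • (1 : Matrix (Fin q) (Fin q) ℂ))
    (Complex.I • (1 : Matrix (Fin q) (Fin q) ℂ)) 0

/-- `I₂ ⊗ v_{q,n} = diag(v_{q,n}, v_{q,n})`. -/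
def kvq (q n : ℕ) :
    Matrix ((Fin (n + 1) × Fin q) ⊕ (Fin (n + 1) × Fin q)) (Fin q ⊕ Fin q) ℂ :=
  Matrix.fromBlocks (vq q n) 0 0 (vq q n)

end

noncomputable section

/-- `Ω_{q,n,α}(ζ)`. -/
def Omg (q n : ℕ) (α : ℝ) (ζ : ℂ) :
    Matrix ((Fin (n + 1) × Fin q) ⊕ (Fin (n + 1) × Fin q))
      ((Fin (n + 1) × Fin q) ⊕ (Fin (n + 1) × Fin q)) ℂ :=
  Matrix.fromBlocks ((ζ - (α : ℂ)) • (bshift q n)ᴴ) (RTs q n (α : ℂ))⁻¹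
      ((-(ζ - (α : ℂ))) • (1 : Matrix (Fin (n + 1) × Fin q) (Fin (n + 1) × Fin q) ℂ))
      ((-(ζ - (α : ℂ))) • (1 : Matrix (Fin (n + 1) × Fin q) (Fin (n + 1) × Fin q) ℂ)) *
    Matrix.fromBlocks (RTs q n ζ) 0 0 (RTs q n ζ)

/-- `Ω̃_{q,n,α}(ζ)`. -/
def OmgT (q n : ℕ) (α : ℝ) (ζ : ℂ) :
    Matrix ((Fin (n + 1) × Fin q) ⊕ (Fin (n + 1) × Fin q))
      ((Fin (n + 1) × Fin q) ⊕ (Fin (n + 1) × Fin q)) ℂ :=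
  Matrix.fromBlocks ((ζ - (α : ℂ)) • (bshift q n)ᴴ) ((ζ - (α : ℂ)) • (RTs q n (α : ℂ))⁻¹)
      (-(1 : Matrix (Fin (n + 1) × Fin q) (Fin (n + 1) × Fin q) ℂ))
      ((-(ζ - (α : ℂ))) • (1 : Matrix (Fin (n + 1) × Fin q) (Fin (n + 1) × Fin q) ℂ)) *
    Matrix.fromBlocks (RTs q n ζ) 0 0 (RTs q n ζ)

/-- The matrix polynomial `Θ_{n,α}(ζ)` built from `H_n^⊐ = G` and `H_{α▷n}^⊐ = Gα`. -/
def Theta (q n : ℕ) (α : ℝ) (s : ℕ → Matrix (Fin q) (Fin q) ℂ)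
    (G Gα : Matrix (Fin (n + 1) × Fin q) (Fin (n + 1) × Fin q) ℂ) (ζ : ℂ) :
    Matrix (Fin q ⊕ Fin q) (Fin q ⊕ Fin q) ℂ :=
  1 + (kvq q n)ᴴ *
      Matrix.fromBlocks (hank q n s) 0 0
        (1 : Matrix (Fin (n + 1) × Fin q) (Fin (n + 1) × Fin q) ℂ) *
      Omg q n α ζ * Matrix.fromBlocks G 0 0 Gα *
      Matrix.fromBlocks (RT q n (α : ℂ)) 0 0 (hank q n s) * kvq q n

/-- The matrix polynomial `Θ̃_{n,α}(ζ)` built from `H_n^⊐ = G` and `H_{α▷n}^⊐ = Gα`. -/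
def ThetaT (q n : ℕ) (α : ℝ) (s : ℕ → Matrix (Fin q) (Fin q) ℂ)
    (G Gα : Matrix (Fin (n + 1) × Fin q) (Fin (n + 1) × Fin q) ℂ) (ζ : ℂ) :
    Matrix (Fin q ⊕ Fin q) (Fin q ⊕ Fin q) ℂ :=
  1 + (kvq q n)ᴴ *
      Matrix.fromBlocks (hank q n s) 0 0
        (1 : Matrix (Fin (n + 1) × Fin q) (Fin (n + 1) × Fin q) ℂ) *
      OmgT q n α ζ * Matrix.fromBlocks G 0 0 Gα *
      Matrix.fromBlocks (RT q n (α : ℂ)) 0 0 (hank q n s) * kvq q n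

end

section Helpers

def rst (q m : ℕ) (x : ℕ → Fin q → ℂ) : Fin (m + 1) × Fin q → ℂ := fun p => x p.1.val p.2

def kerS {q : ℕ} (u : ℕ → Matrix (Fin q) (Fin q) ℂ) (j : ℕ) (x : ℕ → Fin q → ℂ) : Prop :=
  ∀ a ≤ j, ∑ b ∈ Finset.range (j + 1), u (a + b) *ᵥ x b = 0

lemma rst_surj (q m : ℕ) (X : Fin (m + 1) × Fin q → ℂ) : ∃ x, rst q m x = X := by
  refine ⟨fun b k => if h : b < m + 1 then X (⟨b, h⟩, k) else 0, ?_⟩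
  funext p
  obtain ⟨⟨b, hb⟩, k⟩ := p
  simp [rst, hb]

lemma row_mulVec_rst (q m : ℕ) (u : ℕ → Matrix (Fin q) (Fin q) ℂ) (x : ℕ → Fin q → ℂ)
    (a : ℕ) (i : Fin q) :
    ∑ p : Fin (m + 1) × Fin q, u (a + p.1.val) i p.2 * rst q m x p =
      (∑ b ∈ Finset.range (m + 1), u (a + b) *ᵥ x b) i := by
  rw [Finset.sum_range, Fintype.sum_prod_type, Finset.sum_apply]
  rfl

lemma hank_rst (q m : ℕ) (u : ℕ → Matrix (Fin q) (Fin q) ℂ) (x : ℕ → Fin q → ℂ)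
    (p : Fin (m + 1) × Fin q) :
    (hank q m u *ᵥ rst q m x) p =
      (∑ b ∈ Finset.range (m + 1), u (p.1.val + b) *ᵥ x b) p.2 := by
  rw [← row_mulVec_rst]
  rfl

lemma kerS_iff (q m : ℕ) (u : ℕ → Matrix (Fin q) (Fin q) ℂ) (x : ℕ → Fin q → ℂ) :
    kerS u m x ↔ hank q m u *ᵥ rst q m x = 0 := by
  constructor
  · intro h
    funext p
    rw [hank_rst, h _ (by omega)]
    rfl
  · intro h a ha
    funext i
    have := congrFun h (⟨a, by omega⟩, i)
    rw [hank_rst] at this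
    exact this

lemma hank_mono (q : ℕ) {m k : ℕ} (h : m ≤ k) (u : ℕ → Matrix (Fin q) (Fin q) ℂ)
    (hp : (hank q k u).PosSemidef) : (hank q m u).PosSemidef := by
  have := hp.submatrix (fun p : Fin (m + 1) × Fin q =>
    ((⟨p.1.val, by omega⟩, p.2) : Fin (k + 1) × Fin q))
  exact this

lemma kerS_ext {q j : ℕ} {u : ℕ → Matrix (Fin q) (Fin q) ℂ}
    (hp : (hank q (j + 1) u).PosSemidef) {x : ℕ → Fin q → ℂ} (hx : kerS u j x) :
    ∀ a ≤ j + 1, ∑ b ∈ Finset.range (j + 1), u (a + b) *ᵥ x b = 0 := by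
  set x' : ℕ → Fin q → ℂ := fun b => if b ≤ j then x b else 0 with hx'
  have hs : ∀ a, ∑ b ∈ Finset.range (j + 1 + 1), u (a + b) *ᵥ x' b =
      ∑ b ∈ Finset.range (j + 1), u (a + b) *ᵥ x b := by
    intro a
    rw [Finset.sum_range_succ]
    have : x' (j + 1) = 0 := by simp [hx']
    rw [this, Matrix.mulVec_zero, add_zero]
    refine Finset.sum_congr rfl fun b hb => ?_
    have : x' b = x b := by
      have := Finset.mem_range.1 hb
      simp [hx', show b ≤ j by omega]
    rw [this]
  have h0 : star (rst q (j + 1) x') ⬝ᵥ (hank q (j + 1) u *ᵥ rst q (j + 1) x') = 0 := by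
    refine Finset.sum_eq_zero fun p _ => ?_
    rw [hank_rst, hs]
    by_cases hpj : p.1.val ≤ j
    · rw [hx _ hpj]; simp
    · simp [rst, hx', hpj]
  have h1 := (hp.dotProduct_mulVec_zero_iff _).1 h0
  rw [← kerS_iff] at h1
  intro a ha
  rw [← hs]
  exact h1 a ha

lemma hank_entry_herm {q m : ℕ} {u : ℕ → Matrix (Fin q) (Fin q) ℂ}
    (hp : (hank q m u).PosSemidef) : ∀ j ≤ 2 * m, (u j)ᴴ = u j := by
  intro j hj
  ext a b
  have h := hp.1
  have := congrFun (congrFun h (⟨j / 2, by omega⟩, a)) (⟨j - j / 2, by omega⟩, b)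
  simp only [Matrix.conjTranspose_apply, hank, Matrix.of_apply] at this
  rw [show j - j / 2 + j / 2 = j by omega, show j / 2 + (j - j / 2) = j by omega] at this
  exact this

lemma mp_spec_herm {ι : Type*} [Fintype ι] [DecidableEq ι] {A : Matrix ι ι ℂ}
    (hA : A.IsHermitian) : A * mp A * A = A := by
  have hex : ∃ X : Matrix ι ι ℂ,
      A * X * A = A ∧ X * A * X = X ∧ (A * X)ᴴ = A * X ∧ (X * A)ᴴ = X * A := by
    have hsp := hA.spectral_theorem
    rw [Unitary.conjStarAlgAut_apply] at hsp
    set U : Matrix ι ι ℂ := (hA.eigenvectorUnitary : Matrix ι ι ℂ) with hU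
    set d : ι → ℂ := (RCLike.ofReal ∘ hA.eigenvalues : ι → ℂ) with hd
    have hUU : star U * U = 1 := Unitary.coe_star_mul_self hA.eigenvectorUnitary
    have hUU2 : ∀ M : Matrix ι ι ℂ, star U * (U * M) = M := by
      intro M; rw [← Matrix.mul_assoc, hUU, Matrix.one_mul]
    have hdd : star d = d := by
      funext i; simp [hd]
    have e1 : ∀ i, d i * ((d i)⁻¹ * d i) = d i := by
      intro i; by_cases h : d i = 0 <;> simp [h]
    have e2 : ∀ i, (d i)⁻¹ * (d i * (d i)⁻¹) = (d i)⁻¹ := by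
      intro i; by_cases h : d i = 0 <;> simp [h]
    have hsd : ∀ i, (starRingEnd ℂ) (d i) = d i := fun i => congrFun hdd i
    refine ⟨U * diagonal (fun i => (d i)⁻¹) * star U, ?_, ?_, ?_, ?_⟩
    · conv_lhs => rw [hsp]
      conv_rhs => rw [hsp]
      simp only [Matrix.mul_assoc, hUU2]
      simp only [← Matrix.mul_assoc (diagonal _), diagonal_mul_diagonal]
      simp only [e1]
    · rw [hsp]
      simp only [Matrix.mul_assoc, hUU2]
      simp only [← Matrix.mul_assoc (diagonal _), diagonal_mul_diagonal]
      simp only [e2]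
    · rw [hsp]
      simp only [Matrix.mul_assoc, hUU2]
      simp only [← Matrix.mul_assoc (diagonal _), diagonal_mul_diagonal]
      simp only [Matrix.conjTranspose_mul, star_eq_conjTranspose, conjTranspose_conjTranspose,
        diagonal_conjTranspose, Matrix.mul_assoc]
      congr 3
      funext i; simp [hsd]
    · rw [hsp]
      simp only [Matrix.mul_assoc, hUU2]
      simp only [← Matrix.mul_assoc (diagonal _), diagonal_mul_diagonal]
      simp only [Matrix.conjTranspose_mul, star_eq_conjTranspose, conjTranspose_conjTranspose,
        diagonal_conjTranspose, Matrix.mul_assoc]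
      congr 3
      funext i; simp [hsd]
  unfold mp
  rw [dif_pos hex]
  exact hex.choose_spec.1

def Yc (q m : ℕ) (u : ℕ → Matrix (Fin q) (Fin q) ℂ) : Matrix (Fin (m + 1) × Fin q) (Fin q) ℂ :=
  Matrix.of fun (j : Fin (m + 1) × Fin q) (b : Fin q) => u ((m + 1) + j.1.val) j.2 b

def Zr (q m : ℕ) (u : ℕ → Matrix (Fin q) (Fin q) ℂ) : Matrix (Fin q) (Fin (m + 1) × Fin q) ℂ :=
  Matrix.of fun (a : Fin q) (j : Fin (m + 1) × Fin q) => u ((m + 1) + j.1.val) a j.2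

lemma LS_succ (q m : ℕ) (u : ℕ → Matrix (Fin q) (Fin q) ℂ) :
    LS q u (m + 1) = u (2 * (m + 1)) - Zr q m u * mp (hank q m u) * Yc q m u := rfl

lemma Zr_rst (q m : ℕ) (u : ℕ → Matrix (Fin q) (Fin q) ℂ) (x : ℕ → Fin q → ℂ) :
    Zr q m u *ᵥ rst q m x = ∑ b ∈ Finset.range (m + 1), u (m + 1 + b) *ᵥ x b := by
  funext i
  rw [← row_mulVec_rst]
  rfl

lemma Zr_conj {q m : ℕ} {u : ℕ → Matrix (Fin q) (Fin q) ℂ}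
    (hp : (hank q (m + 1) u).PosSemidef) : (Zr q m u)ᴴ = Yc q m u := by
  ext p b
  have h := hank_entry_herm hp (m + 1 + p.1.val) (by omega)
  exact congrFun (congrFun h p.2) b

lemma ZPH {q m : ℕ} {u : ℕ → Matrix (Fin q) (Fin q) ℂ}
    (hp : (hank q (m + 1) u).PosSemidef) :
    Zr q m u * mp (hank q m u) * hank q m u = Zr q m u := by
  have hp0 := hank_mono q (Nat.le_succ m) u hp
  have hm := mp_spec_herm hp0.1
  refine Matrix.ext_of_mulVec_single fun p => ?_
  generalize (Pi.single p (1 : ℂ) : Fin (m + 1) × Fin q → ℂ) = X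
  obtain ⟨x, hx⟩ := rst_surj q m (X - (mp (hank q m u) * hank q m u) *ᵥ X)
  have hk : kerS u m x := by
    rw [kerS_iff, hx, Matrix.mulVec_sub, Matrix.mulVec_mulVec, ← Matrix.mul_assoc, hm, sub_self]
  have := kerS_ext hp hk (m + 1) le_rfl
  rw [← Zr_rst, hx, Matrix.mulVec_sub, Matrix.mulVec_mulVec, ← Matrix.mul_assoc] at this
  exact (sub_eq_zero.1 this).symm

lemma HPY {q m : ℕ} {u : ℕ → Matrix (Fin q) (Fin q) ℂ}
    (hp : (hank q (m + 1) u).PosSemidef) :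
    hank q m u * (mp (hank q m u))ᴴ * Yc q m u = Yc q m u := by
  have hp0 := hank_mono q (Nat.le_succ m) u hp
  have := congrArg conjTranspose (ZPH hp)
  rw [conjTranspose_mul, conjTranspose_mul, Zr_conj hp, hp0.1.eq, ← Matrix.mul_assoc] at this
  exact this

lemma HPY' {q m : ℕ} {u : ℕ → Matrix (Fin q) (Fin q) ℂ}
    (hp : (hank q (m + 1) u).PosSemidef) :
    hank q m u * mp (hank q m u) * Yc q m u = Yc q m u := by
  have hp0 := hank_mono q (Nat.le_succ m) u hp
  have hm := mp_spec_herm hp0.1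
  conv_lhs => rw [← HPY hp]
  rw [← Matrix.mul_assoc, ← Matrix.mul_assoc, hm, HPY hp]

lemma LS_herm {q j : ℕ} {u : ℕ → Matrix (Fin q) (Fin q) ℂ}
    (hp : (hank q j u).PosSemidef) : (LS q u j).IsHermitian := by
  cases j with
  | zero => exact hank_entry_herm hp 0 (by omega)
  | succ m =>
    have hp0 := hank_mono q (Nat.le_succ m) u hp
    have e : Zr q m u * mp (hank q m u) * Yc q m u =
        Zr q m u * mp (hank q m u) * hank q m u * (mp (hank q m u))ᴴ * (Zr q m u)ᴴ := by
      rw [Zr_conj hp]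
      conv_lhs => rw [← HPY hp]
      simp only [Matrix.mul_assoc]
    rw [LS_succ, e]
    refine Matrix.IsHermitian.sub (hank_entry_herm hp _ (by omega)) ?_
    unfold Matrix.IsHermitian
    simp only [conjTranspose_mul, conjTranspose_conjTranspose, hp0.1.eq, Matrix.mul_assoc]

lemma LS_ker {q j : ℕ} {u : ℕ → Matrix (Fin q) (Fin q) ℂ}
    (hp : (hank q j u).PosSemidef) (ξ : Fin q → ℂ) :
    LS q u j *ᵥ ξ = 0 ↔ ∃ x : ℕ → Fin q → ℂ, x j = ξ ∧ kerS u j x := by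
  cases j with
  | zero =>
    constructor
    · intro h
      refine ⟨fun _ => ξ, rfl, ?_⟩
      intro a ha
      obtain rfl : a = 0 := by omega
      simpa [LS] using h
    · rintro ⟨x, rfl, hx⟩
      simpa [LS] using hx 0 le_rfl
  | succ m =>
    have hp0 := hank_mono q (Nat.le_succ m) u hp
    have hL : LS q u (m + 1) *ᵥ ξ = u (m + 1 + (m + 1)) *ᵥ ξ -
        Zr q m u *ᵥ ((mp (hank q m u) * Yc q m u) *ᵥ ξ) := by
      rw [LS_succ, Matrix.sub_mulVec, Matrix.mulVec_mulVec, two_mul, ← Matrix.mul_assoc]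
    have hrow : ∀ (x : ℕ → Fin q → ℂ) (p : Fin (m + 1) × Fin q), x (m + 1) = ξ →
        (∑ b ∈ Finset.range (m + 1 + 1), u (p.1.val + b) *ᵥ x b) p.2 =
          (hank q m u *ᵥ rst q m x + Yc q m u *ᵥ ξ) p := by
      intro x p hx
      rw [Finset.sum_range_succ, Pi.add_apply, Pi.add_apply, hank_rst, hx, add_comm p.1.val (m + 1)]
      rfl
    have hlast : ∀ (x : ℕ → Fin q → ℂ), x (m + 1) = ξ →
        ∑ b ∈ Finset.range (m + 1 + 1), u (m + 1 + b) *ᵥ x b =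
          Zr q m u *ᵥ rst q m x + u (m + 1 + (m + 1)) *ᵥ ξ := by
      intro x hx
      rw [Finset.sum_range_succ, Zr_rst, hx]
    rw [hL]
    constructor
    · intro h
      obtain ⟨x0, hx0⟩ := rst_surj q m (-((mp (hank q m u) * Yc q m u) *ᵥ ξ))
      set x : ℕ → Fin q → ℂ := fun b => if b = m + 1 then ξ else x0 b with hx
      have hxr : rst q m x = -((mp (hank q m u) * Yc q m u) *ᵥ ξ) := by
        rw [← hx0]
        funext p
        have : p.1.val ≠ m + 1 := by omega
        simp [rst, hx, this]
      have hxm : x (m + 1) = ξ := by simp [hx]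
      refine ⟨x, hxm, ?_⟩
      intro a ha
      rcases Nat.lt_or_ge a (m + 1) with h1 | h1
      · funext i
        have := hrow x (⟨a, h1⟩, i) hxm
        rw [hxr, Matrix.mulVec_neg, Matrix.mulVec_mulVec, ← Matrix.mul_assoc, HPY' hp,
          neg_add_cancel] at this
        exact this
      · obtain rfl : a = m + 1 := by omega
        rw [hlast x hxm, hxr, Matrix.mulVec_neg, ← h]
        abel
    · rintro ⟨x, hxm, hk⟩
      have h1 : hank q m u *ᵥ rst q m x + Yc q m u *ᵥ ξ = 0 := by
        funext p
        rw [← hrow x p hxm, hk _ (by omega)]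
        rfl
      have h2 := hk (m + 1) le_rfl
      rw [hlast x hxm] at h2
      rw [← Matrix.mulVec_mulVec, eq_neg_of_add_eq_zero_right h1, Matrix.mulVec_neg,
        Matrix.mulVec_neg, sub_neg_eq_add, Matrix.mulVec_mulVec, Matrix.mulVec_mulVec,
        ZPH hp, add_comm]
      exact h2

lemma chain1 {q j : ℕ} {α : ℝ} {t : ℕ → Matrix (Fin q) (Fin q) ℂ}
    (hp : (hank q (j + 1) t).PosSemidef) (hpα : (hank q j (sShift α t)).PosSemidef)
    (ξ : Fin q → ℂ) (h : LS q t j *ᵥ ξ = 0) : LS q (sShift α t) j *ᵥ ξ = 0 := by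
  rw [LS_ker (hank_mono q (Nat.le_succ j) t hp)] at h
  rw [LS_ker hpα]
  obtain ⟨x, hx, hk⟩ := h
  refine ⟨x, hx, fun a ha => ?_⟩
  have e := kerS_ext hp hk
  have e0 := e a (by omega)
  have e1 := e (a + 1) (by omega)
  simp only [sShift, Matrix.add_mulVec, Matrix.smul_mulVec, Finset.sum_add_distrib,
    ← Finset.smul_sum]
  rw [e0, smul_zero, zero_add, ← e1]
  refine Finset.sum_congr rfl fun b _ => ?_
  rw [add_right_comm]

lemma chain2 {q j : ℕ} {α : ℝ} {t : ℕ → Matrix (Fin q) (Fin q) ℂ}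
    (hp : (hank q (j + 1) t).PosSemidef) (hpα : (hank q (j + 1) (sShift α t)).PosSemidef)
    (ξ : Fin q → ℂ) (h : LS q (sShift α t) j *ᵥ ξ = 0) : LS q t (j + 1) *ᵥ ξ = 0 := by
  rw [LS_ker (hank_mono q (Nat.le_succ j) _ hpα)] at h
  rw [LS_ker hp]
  obtain ⟨x, hx, hk⟩ := h
  refine ⟨fun b => (if b = 0 then 0 else x (b - 1)) - (α : ℂ) • (if b = j + 1 then 0 else x b),
    by simp [hx], fun a ha => ?_⟩
  have e := kerS_ext hpα hk a ha
  simp only [Matrix.mulVec_sub, Matrix.mulVec_smul, Finset.sum_sub_distrib, ← Finset.smul_sum]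
  rw [Finset.sum_range_succ' (fun b => t (a + b) *ᵥ (if b = 0 then 0 else x (b - 1))),
    Finset.sum_range_succ (fun b => t (a + b) *ᵥ (if b = j + 1 then 0 else x b))]
  simp only [sShift, Matrix.add_mulVec, Matrix.smul_mulVec, Finset.sum_add_distrib,
    ← Finset.smul_sum] at e
  have e2 : ∑ b ∈ Finset.range (j + 1), t (a + b) *ᵥ (if b = j + 1 then 0 else x b) =
      ∑ b ∈ Finset.range (j + 1), t (a + b) *ᵥ x b := by
    refine Finset.sum_congr rfl fun b hb => ?_
    have := Finset.mem_range.1 hb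
    rw [if_neg (by omega)]
  rw [e2]
  simp only [Nat.add_eq_zero_iff, one_ne_zero, and_false, if_false, if_true, Matrix.mulVec_zero,
    add_zero, Nat.add_sub_cancel]
  rw [← e, neg_smul, add_comm, sub_eq_add_neg, add_comm]
  simp only [add_assoc]

lemma range_le_of_ker {q : ℕ} {L M : Matrix (Fin q) (Fin q) ℂ} (hL : L.IsHermitian)
    (hM : M.IsHermitian) (h : ∀ ξ, L *ᵥ ξ = 0 → M *ᵥ ξ = 0) :
    ∃ W, M = L * W := by
  have hm := mp_spec_herm hL
  have e : M * mp L * L = M := by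
    refine Matrix.ext_of_mulVec_single fun p => ?_
    generalize (Pi.single p (1 : ℂ) : Fin q → ℂ) = X
    have := h (X - (mp L * L) *ᵥ X) (by
      rw [Matrix.mulVec_sub, Matrix.mulVec_mulVec, ← Matrix.mul_assoc, hm, sub_self])
    rw [Matrix.mulVec_sub, Matrix.mulVec_mulVec, ← Matrix.mul_assoc] at this
    exact (sub_eq_zero.1 this).symm
  have := congrArg conjTranspose e
  rw [conjTranspose_mul, conjTranspose_mul, hL.eq, hM.eq] at this
  exact ⟨_, this.symm⟩

lemma rgi_herm {ι : Type*} [Fintype ι] [DecidableEq ι] {H G : Matrix ι ι ℂ}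
    {D : Submodule ℂ (ι → ℂ)} (hH : Hᴴ = H) (h : IsRGI H G D) : Gᴴ = G := by
  obtain ⟨-, h2, h3, h4⟩ := h
  have hk : ∀ x, G *ᵥ x = 0 → Gᴴ *ᵥ x = 0 := by
    intro x hx
    have h5 := (h4 x).1 hx
    have h6 : star (G *ᵥ (Gᴴ *ᵥ x)) ⬝ᵥ x = 0 := h5 _ (by rw [← h3]; exact ⟨_, rfl⟩)
    rw [Matrix.star_mulVec, ← Matrix.dotProduct_mulVec] at h6
    exact dotProduct_star_self_eq_zero.1 h6
  have e : Gᴴ * H * G = Gᴴ := by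
    refine Matrix.ext_of_mulVec_single fun p => ?_
    generalize (Pi.single p (1 : ℂ) : ι → ℂ) = X
    have := hk ((H * G) *ᵥ X - X) (by
      rw [Matrix.mulVec_sub, Matrix.mulVec_mulVec, ← Matrix.mul_assoc, h2, sub_self])
    rw [Matrix.mulVec_sub, Matrix.mulVec_mulVec, ← Matrix.mul_assoc] at this
    exact sub_eq_zero.1 this
  have e2 := congrArg conjTranspose e
  rw [conjTranspose_mul, conjTranspose_mul, conjTranspose_conjTranspose, hH,
    ← Matrix.mul_assoc, e] at e2
  exact e2

lemma rgi_fix {ι : Type*} [Fintype ι] [DecidableEq ι] {H G M : Matrix ι ι ℂ}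
    {D : Submodule ℂ (ι → ℂ)} (h : IsRGI H G D) (hM : ∀ x, M *ᵥ x ∈ D) : G * H * M = M := by
  obtain ⟨-, h2, h3, -⟩ := h
  refine Matrix.ext_of_mulVec_single fun p => ?_
  generalize (Pi.single p (1 : ℂ) : ι → ℂ) = X
  have := hM X
  rw [← h3] at this
  obtain ⟨y, hy⟩ := this
  rw [Matrix.mulVecLin_apply] at hy
  rw [← Matrix.mulVec_mulVec, ← hy, Matrix.mulVec_mulVec, h2]

lemma rgi_mem {ι : Type*} [Fintype ι] {H G : Matrix ι ι ℂ}
    {D : Submodule ℂ (ι → ℂ)} (h : IsRGI H G D) (x) : G *ᵥ x ∈ D := by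
  rw [← h.2.2.1]; exact ⟨x, rfl⟩

lemma mem_Dsub {q n : ℕ} {u : ℕ → Matrix (Fin q) (Fin q) ℂ} (x : Fin (n + 1) × Fin q → ℂ) :
    x ∈ Dsub q n u ↔ ∀ j : Fin (n + 1), ∃ η, (fun a => x (j, a)) = LS q u j.val *ᵥ η := by
  have key : ∀ (y : Fin (n + 1) × Fin q → ℂ) j,
      (fun a => (Ldiag q n u *ᵥ y) (j, a)) = LS q u j.val *ᵥ fun b => y (j, b) := by
    intro y j
    funext a
    simp only [Matrix.mulVec, dotProduct, Ldiag, Matrix.of_apply, Fintype.sum_prod_type]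
    rw [Finset.sum_eq_single j]
    · simp
    · intro b _ hb
      simp [hb.symm]
    · simp
  constructor
  · rintro ⟨y, rfl⟩ j
    exact ⟨_, key y j⟩
  · intro h
    choose η hη using h
    refine ⟨fun p => η p.1 p.2, ?_⟩
    funext p
    have := key (fun p => η p.1 p.2) p.1
    have h2 := hη p.1
    exact congrFun (this.trans h2.symm) p.2

lemma mul_bshiftH_zero {q n : ℕ} {ι : Type*} (M : Matrix ι (Fin (n + 1) × Fin q) ℂ) (p : ι)
    (b : Fin q) : (M * (bshift q n)ᴴ) p (0, b) = 0 := by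
  simp [Matrix.mul_apply, bshift]

lemma mul_bshiftH_succ {q n : ℕ} {ι : Type*} (M : Matrix ι (Fin (n + 1) × Fin q) ℂ) (p : ι)
    (k : Fin n) (b : Fin q) : (M * (bshift q n)ᴴ) p (k.succ, b) = M p (k.castSucc, b) := by
  rw [Matrix.mul_apply, Finset.sum_eq_single (k.castSucc, b)]
  · simp [bshift]
  · rintro ⟨r, c⟩ _ hr
    have : ¬ (k.val = r.val ∧ b = c) := by
      rintro ⟨h1, rfl⟩
      exact hr (by ext <;> simp [h1])
    simp [bshift, this]
  · simp

lemma bshiftH_mulVec {q n : ℕ} (x : Fin (n + 1) × Fin q → ℂ) (j : Fin (n + 1)) (a : Fin q) :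
    ((bshift q n)ᴴ *ᵥ x) (j, a) =
      if h : j.val + 1 < n + 1 then x (⟨j.val + 1, h⟩, a) else 0 := by
  rw [Matrix.mulVec, dotProduct]
  split_ifs with h
  · rw [Finset.sum_eq_single (⟨j.val + 1, h⟩, a)]
    · simp [bshift]
    · rintro ⟨r, c⟩ _ hr
      have : ¬ (r.val = j.val + 1 ∧ c = a) := by
        rintro ⟨h1, rfl⟩
        exact hr (by ext <;> simp [h1])
      simp [bshift, this]
    · simp
  · refine Finset.sum_eq_zero ?_
    rintro ⟨r, c⟩ _
    have : ¬ (r.val = j.val + 1 ∧ c = a) := by omega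
    simp [bshift, this]

lemma bshiftH_nilp (q n : ℕ) : IsNilpotent (bshift q n)ᴴ := by
  refine ⟨n + 1, ?_⟩
  have key : ∀ (k : ℕ) (x : Fin (n + 1) × Fin q → ℂ) (j : Fin (n + 1)) (a : Fin q),
      n + 1 ≤ j.val + k → (((bshift q n)ᴴ ^ k) *ᵥ x) (j, a) = 0 := by
    intro k
    induction k with
    | zero => intro x j a h; omega
    | succ k ih =>
      intro x j a h
      rw [pow_succ', ← Matrix.mulVec_mulVec, bshiftH_mulVec]
      split_ifs with h1
      · exact ih x _ a (by simp only; omega)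
      · rfl
  refine Matrix.ext_of_mulVec_single fun p => ?_
  funext r
  rw [Matrix.zero_mulVec]
  exact key _ _ r.1 r.2 (by omega)

lemma hank_lyap (q n : ℕ) (α : ℝ) (t : ℕ → Matrix (Fin q) (Fin q) ℂ) :
    hank q n t * (vq q n * (vq q n)ᴴ) =
      hank q n t * (1 - (α : ℂ) • (bshift q n)ᴴ) - hank q n (sShift α t) * (bshift q n)ᴴ := by
  have hv0 : ∀ p b, (hank q n t * (vq q n * (vq q n)ᴴ)) p (0, b) = hank q n t p (0, b) := by
    intro p b
    rw [Matrix.mul_apply, Finset.sum_eq_single (0, b)]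
    · simp [Matrix.mul_apply, vq]
    · rintro ⟨r, c⟩ _ hr
      simp only [Matrix.mul_apply, vq, Matrix.of_apply, conjTranspose_apply]
      rw [Finset.sum_eq_zero, mul_zero]
      intro e _
      by_cases h1 : b = e
      · subst h1
        have : ¬ (r.val = 0 ∧ c = b) := by
          rintro ⟨h1, rfl⟩
          exact hr (by ext <;> simp [h1])
        rw [if_neg this, zero_mul]
      · simp [h1]
    · simp
  have hv1 : ∀ p (k : Fin n) b, (hank q n t * (vq q n * (vq q n)ᴴ)) p (k.succ, b) = 0 := by
    intro p k b
    rw [Matrix.mul_apply]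
    refine Finset.sum_eq_zero fun r _ => ?_
    simp [Matrix.mul_apply, vq]
  ext p ⟨k, b⟩
  rw [Matrix.mul_sub, Matrix.mul_one, Matrix.mul_smul, Matrix.sub_apply, Matrix.sub_apply,
    Matrix.smul_apply]
  refine Fin.cases ?_ (fun k => ?_) k
  · rw [hv0, mul_bshiftH_zero, mul_bshiftH_zero]; simp
  · rw [hv1, mul_bshiftH_succ, mul_bshiftH_succ]
    simp [hank, sShift, add_assoc]
    ring

lemma RTs_mul (q n : ℕ) (z : ℂ) :
    RTs q n z * (1 - z • (bshift q n)ᴴ) = 1 ∧ (1 - z • (bshift q n)ᴴ) * RTs q n z = 1 := by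
  have h : IsUnit (1 - z • (bshift q n)ᴴ) := ((bshiftH_nilp q n).smul z).isUnit_one_sub
  rw [Matrix.isUnit_iff_isUnit_det] at h
  exact ⟨Matrix.nonsing_inv_mul _ h, Matrix.mul_nonsing_inv _ h⟩

lemma RTs_conj (q n : ℕ) (z : ℂ) : (RTs q n (conj z))ᴴ = RT q n z := by
  simp [RTs, RT, Matrix.conjTranspose_nonsing_inv, conjTranspose_sub, conjTranspose_smul]

lemma RT_conj (q n : ℕ) (α : ℝ) : (RT q n (α : ℂ))ᴴ = RTs q n (α : ℂ) := by
  have := RTs_conj q n (α : ℂ)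
  rw [Complex.conj_ofReal] at this
  rw [← this, conjTranspose_conjTranspose]

lemma RT_mul (q n : ℕ) (z : ℂ) :
    RT q n z * (1 - z • bshift q n) = 1 ∧ (1 - z • bshift q n) * RT q n z = 1 := by
  have h : (1 - z • bshift q n) = (1 - conj z • (bshift q n)ᴴ)ᴴ := by
    simp [conjTranspose_sub, conjTranspose_smul]
  have e := RTs_mul q n (conj z)
  rw [h, ← RTs_conj, ← conjTranspose_mul, ← conjTranspose_mul, e.1, e.2]
  simp

lemma comm_inv {M : Type*} [Ring M] {T X S : M} (h1 : S * X = 1) (h2 : X * S = 1)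
    (hc : T * X = X * T) : T * S = S * T := by
  calc T * S = S * X * T * S := by rw [h1, one_mul]
    _ = S * (T * X) * S := by rw [hc, mul_assoc S X T]
    _ = S * T := by rw [mul_assoc, mul_assoc, h2, mul_one]

lemma alg_core {M : Type*} [Ring M] [Algebra ℂ M] {H G Ga T Ts A As B A' R S Q : M} {z a : ℂ}
    (hA' : A' = 1 - a • T) (hB : B = 1 - a • Ts)
    (hA1 : A * A' = 1) (hA2 : A' * A = 1) (hB2 : B * As = 1)
    (hR1 : R * (1 - z • Ts) = 1) (hR2 : (1 - z • Ts) * R = 1)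
    (hS1 : S * (1 - z • T) = 1) (hS2 : (1 - z • T) * S = 1)
    (E1 : Ga * H * Q * As * G = Ga - Ts * As * G)
    (E2 : G * A * Q * H * Ga = Ga - G * A * T) :
    (-(As * G * S) + (z - a) • (R * Ga * H * Q * As * G * S) + R * G * A
      - (z - a) • (R * G * A * Q * H * Ga * S) = 0) ∧
    (-((z - a) • (R * Ga * H)) + (z - a) • (As * G * S * T * H)
      - (z - a) • (z - a) • (R * Ga * H * Q * As * G * S * T * H)
      + (z - a) • (R * G * A * Q * H * Ga * S * A' * H) = 0) ∧
    (H * B * R * Ga * H + (z - a) • (H * B * R * Ga * H * Q * As * G * S * T * H)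
      - H * Ga * S * A' * H - (z - a) • (H * Ts * R * G * A * Q * H * Ga * S * A' * H) = 0) := by
  set w := z - a with hw
  have cTX : ∀ (N : M) (c : ℂ), N * (1 - c • N) = (1 - c • N) * N := by
    intro N c; simp [mul_sub, sub_mul]
  have hAX' : A' = (1 - z • T) + w • T := by rw [hA', hw]; module
  have hBX : B = (1 - z • Ts) + w • Ts := by rw [hB, hw]; module
  have cTS : T * S = S * T := comm_inv hS1 hS2 (cTX _ _)
  have cTR : Ts * R = R * Ts := comm_inv hR1 hR2 (cTX _ _)
  have cTA : T * A = A * T := comm_inv hA1 hA2 (by rw [hA']; exact cTX _ _)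
  have r1 : w • (R * Ts * As) = R - As := by
    have : R * (B - (1 - z • Ts)) * As = R - As := by
      rw [mul_sub, sub_mul, hR1, one_mul, mul_assoc, hB2, mul_one]
    rw [← this, hBX]; simp
  have r2 : w • (A * T * S) = S - A := by
    have : A * (A' - (1 - z • T)) * S = S - A := by
      rw [mul_sub, sub_mul, hA1, one_mul, mul_assoc A _ S, hS2, mul_one]
    rw [← this, hAX']; simp
  have r3 : S * A' = 1 + w • (S * T) := by rw [hAX', mul_add, hS1]; simp
  have r3' : A' * S = 1 + w • (S * T) := by rw [hAX', add_mul, hS2]; simp [cTS]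
  have r4 : B * R = 1 + w • (Ts * R) := by rw [hBX, add_mul, hR2]; simp
  have r4' : R * B = 1 + w • (Ts * R) := by rw [hBX, mul_add, hR1]; simp [cTR]
  have r5 : A * T * S * A' = S * T := by
    rw [mul_assoc (A * T), r3, ← r3', ← cTA, mul_assoc, ← mul_assoc A, hA1, one_mul, cTS]
  have cTB : Ts * B = B * Ts := by rw [hB]; exact cTX _ _
  have r6 : B * R * Ts * As = Ts * R := by
    rw [r4, ← r4', mul_assoc R B, ← cTB, ← mul_assoc, mul_assoc, hB2, mul_one, cTR]
  have h1 : w • (R * Ga * H * Q * As * G * S) = w • (R * Ga * S) - (R - As) * G * S := by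
    rw [← r1]
    have : R * Ga * H * Q * As * G * S = R * (Ga * H * Q * As * G) * S := by
      simp only [mul_assoc]
    rw [this, E1]
    simp only [mul_sub, sub_mul, smul_sub, mul_assoc, smul_mul_assoc]
  have h2 : w • (R * G * A * Q * H * Ga * S) = w • (R * Ga * S) - R * G * (S - A) := by
    rw [← r2]
    have : R * G * A * Q * H * Ga * S = R * (G * A * Q * H * Ga) * S := by
      simp only [mul_assoc]
    rw [this, E2]
    simp only [mul_sub, sub_mul, smul_sub, mul_assoc, mul_smul_comm]
  refine ⟨?_, ?_, ?_⟩
  · rw [h1, h2]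
    simp only [mul_sub, sub_mul]
    abel
  · have e1 : w • (R * Ga * H * Q * As * G * S * T * H) =
        (w • (R * Ga * S) - (R - As) * G * S) * T * H := by
      rw [← h1]; simp only [smul_mul_assoc]
    have e2 : R * G * A * Q * H * Ga * S * A' * H =
        R * Ga * (S * A') * H - R * G * (A * T * S * A') * H := by
      have : R * G * A * Q * H * Ga * S * A' * H = R * (G * A * Q * H * Ga) * S * A' * H := by
        simp only [mul_assoc]
      rw [this, E2]
      simp only [mul_sub, sub_mul, mul_assoc]
    rw [e1, e2, r5, r3]
    simp only [mul_sub, sub_mul, mul_add, add_mul, mul_one, smul_sub, smul_add, mul_assoc,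
      smul_mul_assoc, mul_smul_comm]
    abel
  · have e1 : H * B * R * Ga * H * Q * As * G * S * T * H =
        H * (B * R) * Ga * (S * T) * H - H * (B * R * Ts * As) * G * S * T * H := by
      have : H * B * R * Ga * H * Q * As * G * S * T * H =
          H * B * R * (Ga * H * Q * As * G) * S * T * H := by
        simp only [mul_assoc]
      rw [this, E1]
      simp only [mul_sub, sub_mul, mul_assoc]
    have e2 : H * Ts * R * G * A * Q * H * Ga * S * A' * H =
        H * Ts * R * Ga * (S * A') * H - H * Ts * R * G * (A * T * S * A') * H := by
      have : H * Ts * R * G * A * Q * H * Ga * S * A' * H =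
          H * Ts * R * (G * A * Q * H * Ga) * S * A' * H := by
        simp only [mul_assoc]
      rw [this, E2]
      simp only [mul_sub, sub_mul, mul_assoc]
    have e3 : H * B * R * Ga * H = H * (B * R) * Ga * H := by simp only [mul_assoc]
    have e4 : H * Ga * S * A' * H = H * Ga * (S * A') * H := by simp only [mul_assoc]
    rw [e1, e2, e3, e4, r5, r6, r3, r4]
    simp only [mul_sub, sub_mul, mul_add, add_mul, mul_one, one_mul, smul_sub, smul_add, mul_assoc,
      smul_mul_assoc, mul_smul_comm]
    abel

lemma Theta_blocks (q n : ℕ) (α : ℝ) (s : ℕ → Matrix (Fin q) (Fin q) ℂ)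
    (G Gα : Matrix (Fin (n + 1) × Fin q) (Fin (n + 1) × Fin q) ℂ) (ζ : ℂ) :
    Theta q n α s G Gα ζ = Matrix.fromBlocks
      (1 + (ζ - α) • ((vq q n)ᴴ * (hank q n s * (bshift q n)ᴴ * RTs q n ζ * G * RT q n α) * vq q n))
      ((vq q n)ᴴ * (hank q n s * (RTs q n α)⁻¹ * RTs q n ζ * Gα * hank q n s) * vq q n)
      (-((ζ - α) • ((vq q n)ᴴ * (RTs q n ζ * G * RT q n α) * vq q n)))
      (1 - (ζ - α) • ((vq q n)ᴴ * (RTs q n ζ * Gα * hank q n s) * vq q n)) := by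
  rw [Theta, Omg, kvq, ← Matrix.fromBlocks_one]
  simp only [Matrix.fromBlocks_conjTranspose, Matrix.fromBlocks_multiply, Matrix.fromBlocks_add,
    Matrix.mul_zero, Matrix.zero_mul, add_zero, zero_add, Matrix.one_mul, Matrix.mul_one,
    Matrix.conjTranspose_zero, Matrix.mul_smul, Matrix.smul_mul, Matrix.mul_assoc, neg_smul,
    Matrix.mul_neg, Matrix.neg_mul, sub_eq_add_neg, smul_zero, neg_zero]

lemma ThetaT_blocks (q n : ℕ) (α : ℝ) (s : ℕ → Matrix (Fin q) (Fin q) ℂ)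
    (G Gα : Matrix (Fin (n + 1) × Fin q) (Fin (n + 1) × Fin q) ℂ) (ζ : ℂ) :
    ThetaT q n α s G Gα ζ = Matrix.fromBlocks
      (1 + (ζ - α) • ((vq q n)ᴴ * (hank q n s * (bshift q n)ᴴ * RTs q n ζ * G * RT q n α) * vq q n))
      ((ζ - α) • ((vq q n)ᴴ * (hank q n s * (RTs q n α)⁻¹ * RTs q n ζ * Gα * hank q n s) * vq q n))
      (-((vq q n)ᴴ * (RTs q n ζ * G * RT q n α) * vq q n))
      (1 - (ζ - α) • ((vq q n)ᴴ * (RTs q n ζ * Gα * hank q n s) * vq q n)) := by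
  rw [ThetaT, OmgT, kvq, ← Matrix.fromBlocks_one]
  simp only [Matrix.fromBlocks_conjTranspose, Matrix.fromBlocks_multiply, Matrix.fromBlocks_add,
    Matrix.mul_zero, Matrix.zero_mul, add_zero, zero_add, Matrix.one_mul, Matrix.mul_one,
    Matrix.conjTranspose_zero, Matrix.mul_smul, Matrix.smul_mul, Matrix.mul_assoc, neg_smul,
    Matrix.mul_neg, Matrix.neg_mul, sub_eq_add_neg, smul_zero, neg_zero]

lemma J_blocks {q : ℕ} {a b c d a' b' c' d' : Matrix (Fin q) (Fin q) ℂ}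
    (h11 : b * a'ᴴ - a * b'ᴴ = 0) (h12 : a * d'ᴴ - b * c'ᴴ = 1)
    (h21 : d * a'ᴴ - c * b'ᴴ = 1) (h22 : d * c'ᴴ - c * d'ᴴ = 0) :
    Matrix.fromBlocks a b c d * Jmat q * (Matrix.fromBlocks a' b' c' d')ᴴ = Jmat q := by
  have g11 : b * a'ᴴ = a * b'ᴴ := sub_eq_zero.1 h11
  have g22 : d * c'ᴴ = c * d'ᴴ := sub_eq_zero.1 h22
  rw [Jmat, Matrix.fromBlocks_conjTranspose, Matrix.fromBlocks_multiply,
    Matrix.fromBlocks_multiply]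
  simp only [Matrix.mul_zero, zero_add, add_zero, Matrix.mul_smul, Matrix.smul_mul,
    Matrix.mul_one, neg_smul, Matrix.neg_mul, Matrix.mul_neg]
  congr 1
  · rw [g11]; abel
  · rw [← h12, smul_sub]; abel
  · rw [← h21, smul_sub]; abel
  · rw [g22]; abel

lemma J_inv {q : ℕ} {X Y : Matrix (Fin q ⊕ Fin q) (Fin q ⊕ Fin q) ℂ}
    (h : X * Jmat q * Yᴴ = Jmat q) : IsUnit X ∧ X⁻¹ = Jmat q * Yᴴ * Jmat q := by
  have hJ : Jmat q * Jmat q = 1 := by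
    rw [Jmat, Matrix.fromBlocks_multiply, ← Matrix.fromBlocks_one]
    simp [smul_smul]
  have e : X * (Jmat q * Yᴴ * Jmat q) = 1 := by
    rw [← Matrix.mul_assoc, ← Matrix.mul_assoc, h, hJ]
  exact ⟨IsUnit.of_mul_eq_one _ e, Matrix.inv_eq_right_inv e⟩

lemma core_ids {q n : ℕ} {α : ℝ} {H G Ga K : Matrix (Fin (n + 1) × Fin q) (Fin (n + 1) × Fin q) ℂ}
    (hH : Hᴴ = H) (hG : Gᴴ = G) (hGa : Gaᴴ = Ga)
    (hly : H * (vq q n * (vq q n)ᴴ) = H * (1 - (α : ℂ) • (bshift q n)ᴴ) - K * (bshift q n)ᴴ)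
    (hGHGa : G * H * Ga = Ga)
    (hfix : Ga * K * ((bshift q n)ᴴ * RTs q n α * G) = (bshift q n)ᴴ * RTs q n α * G)
    (a b c d : ℂ → Matrix (Fin q) (Fin q) ℂ)
    (ha : ∀ z, a z = 1 + (z - α) •
      ((vq q n)ᴴ * (H * (bshift q n)ᴴ * RTs q n z * G * RT q n α) * vq q n))
    (hb : ∀ z, b z = (vq q n)ᴴ * (H * (RTs q n α)⁻¹ * RTs q n z * Ga * H) * vq q n)
    (hc : ∀ z, c z = (vq q n)ᴴ * (RTs q n z * G * RT q n α) * vq q n)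
    (hd : ∀ z, d z = 1 - (z - α) • ((vq q n)ᴴ * (RTs q n z * Ga * H) * vq q n)) (z : ℂ) :
    b z * (a (conj z))ᴴ - a z * (b (conj z))ᴴ = 0 ∧
    d z * (a (conj z))ᴴ + (z - α) • (c z * (b (conj z))ᴴ) = 1 ∧
    d z * (c (conj z))ᴴ - c z * (d (conj z))ᴴ = 0 := by
  have hB : (RTs q n (α : ℂ))⁻¹ = 1 - (α : ℂ) • (bshift q n)ᴴ :=
    Matrix.inv_eq_right_inv (RTs_mul q n α).1
  have hBH : ((1 : Matrix (Fin (n + 1) × Fin q) (Fin (n + 1) × Fin q) ℂ)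
      - (α : ℂ) • (bshift q n)ᴴ)ᴴ = 1 - (α : ℂ) • bshift q n := by
    simp [conjTranspose_sub, conjTranspose_smul]
  have hw : star (conj z - (α : ℂ)) = z - α := by simp
  have hGaHG : Ga * H * G = Ga := by
    have := congrArg conjTranspose hGHGa
    rwa [conjTranspose_mul, conjTranspose_mul, hH, hG, hGa, ← Matrix.mul_assoc] at this
  have E1 : Ga * H * (vq q n * (vq q n)ᴴ) * RTs q n α * G =
      Ga - (bshift q n)ᴴ * RTs q n α * G := by
    have : Ga * H * (vq q n * (vq q n)ᴴ) * RTs q n α * G =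
        Ga * (H * (vq q n * (vq q n)ᴴ)) * RTs q n α * G := by simp only [Matrix.mul_assoc]
    rw [this, hly]
    have e : Ga * (H * (1 - (α : ℂ) • (bshift q n)ᴴ) - K * (bshift q n)ᴴ) * RTs q n α * G =
        Ga * H * ((1 - (α : ℂ) • (bshift q n)ᴴ) * RTs q n α) * G
          - Ga * K * ((bshift q n)ᴴ * RTs q n α * G) := by
      rw [Matrix.mul_sub, Matrix.sub_mul, Matrix.sub_mul]
      simp only [Matrix.mul_assoc]
    rw [e, (RTs_mul q n α).2, hfix, Matrix.mul_one, hGaHG]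
  have E2 : G * RT q n α * (vq q n * (vq q n)ᴴ) * H * Ga = Ga - G * RT q n α * bshift q n := by
    have := congrArg conjTranspose E1
    simp only [conjTranspose_mul, conjTranspose_sub, conjTranspose_conjTranspose, hH, hG, hGa,
      ← RT_conj] at this
    simpa only [Matrix.mul_assoc] using this
  obtain ⟨i22, i21, i11⟩ := alg_core (z := z) (a := (α : ℂ)) rfl rfl (RT_mul q n α).1
    (RT_mul q n α).2 (RTs_mul q n α).2 (RTs_mul q n z).1 (RTs_mul q n z).2 (RT_mul q n z).1
    (RT_mul q n z).2 E1 E2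
  have ha' : (a (conj z))ᴴ = 1 + (z - α) •
      ((vq q n)ᴴ * (RTs q n α * G * RT q n z * bshift q n * H) * vq q n) := by
    rw [ha]
    simp only [conjTranspose_add, conjTranspose_smul, conjTranspose_one, conjTranspose_mul,
      conjTranspose_conjTranspose, hw, hH, hG, RT_conj, RTs_conj, Matrix.mul_assoc]
  have hb' : (b (conj z))ᴴ = (vq q n)ᴴ * (H * Ga * RT q n z *
      (1 - (α : ℂ) • bshift q n) * H) * vq q n := by
    rw [hb, hB]
    simp only [conjTranspose_mul,
      conjTranspose_conjTranspose, hH, hGa, hBH, RTs_conj, Matrix.mul_assoc]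
  have hc' : (c (conj z))ᴴ = (vq q n)ᴴ * (RTs q n α * G * RT q n z) * vq q n := by
    rw [hc]
    simp only [conjTranspose_mul,
      conjTranspose_conjTranspose, hG, RT_conj, RTs_conj, Matrix.mul_assoc]
  have hd' : (d (conj z))ᴴ = 1 - (z - α) • ((vq q n)ᴴ * (H * Ga * RT q n z) * vq q n) := by
    rw [hd]
    simp only [conjTranspose_sub, conjTranspose_smul, conjTranspose_one, conjTranspose_mul,
      conjTranspose_conjTranspose, hw, hH, hGa, RTs_conj, Matrix.mul_assoc]
  rw [ha', hb', hc', hd', ha, hb, hc, hd, hB]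
  generalize (1 : Matrix (Fin (n + 1) × Fin q) (Fin (n + 1) × Fin q) ℂ)
    - (α : ℂ) • (bshift q n)ᴴ = B at *
  generalize (1 : Matrix (Fin (n + 1) × Fin q) (Fin (n + 1) × Fin q) ℂ)
    - (α : ℂ) • (bshift q n) = A' at *
  generalize z - (α : ℂ) = w at *
  have j22 := congrArg (fun X => (vq q n)ᴴ * X * vq q n) i22
  have j21 := congrArg (fun X => (vq q n)ᴴ * X * vq q n) i21
  have j11 := congrArg (fun X => (vq q n)ᴴ * X * vq q n) i11
  simp only [Matrix.mul_add, Matrix.add_mul, Matrix.mul_sub, Matrix.sub_mul, Matrix.mul_smul,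
    Matrix.smul_mul, Matrix.mul_neg, Matrix.neg_mul, Matrix.mul_zero, Matrix.zero_mul,
    Matrix.mul_assoc] at j22 j21 j11
  simp only [Matrix.mul_add, Matrix.add_mul, Matrix.mul_sub, Matrix.sub_mul, Matrix.mul_smul,
    Matrix.smul_mul, Matrix.mul_neg, Matrix.neg_mul, Matrix.mul_zero, Matrix.zero_mul,
    Matrix.mul_one, Matrix.one_mul, Matrix.mul_assoc]
  refine ⟨?_, ?_, ?_⟩
  · rw [← j11]; module
  · rw [← sub_eq_zero, ← j21]; module
  · rw [← neg_eq_zero, ← j22]; module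

lemma D_incl {q n : ℕ} {α : ℝ} {t : ℕ → Matrix (Fin q) (Fin q) ℂ}
    (hp : (hank q (n + 1) t).PosSemidef) (hpα : (hank q n (sShift α t)).PosSemidef) :
    (∀ x ∈ Dsub q n (sShift α t), x ∈ Dsub q n t) ∧
    (∀ x ∈ Dsub q n t, (bshift q n)ᴴ *ᵥ (RTs q n α *ᵥ x) ∈ Dsub q n (sShift α t)) := by
  have c1 : ∀ j ≤ n, ∃ W, LS q (sShift α t) j = LS q t j * W := fun j hj =>
    range_le_of_ker (LS_herm (hank_mono q (by omega) _ hp)) (LS_herm (hank_mono q hj _ hpα))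
      (chain1 (hank_mono q (by omega) _ hp) (hank_mono q hj _ hpα))
  have c2 : ∀ j, j + 1 ≤ n → ∃ W, LS q t (j + 1) = LS q (sShift α t) j * W := fun j hj =>
    range_le_of_ker (LS_herm (hank_mono q (by omega) _ hpα)) (LS_herm (hank_mono q (by omega) _ hp))
      (chain2 (hank_mono q (by omega) _ hp) (hank_mono q hj _ hpα))
  have i1 : ∀ x ∈ Dsub q n (sShift α t), x ∈ Dsub q n t := by
    intro x hx
    rw [mem_Dsub] at hx ⊢
    intro j
    obtain ⟨η, hη⟩ := hx j
    obtain ⟨W, hW⟩ := c1 j.val (by omega)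
    exact ⟨W *ᵥ η, by rw [hη, hW, Matrix.mulVec_mulVec]⟩
  refine ⟨i1, ?_⟩
  intro x hx
  rw [mem_Dsub] at hx
  set y := RTs q n α *ᵥ x with hy
  have hyx : y = x + (α : ℂ) • ((bshift q n)ᴴ *ᵥ y) := by
    have : (1 - (α : ℂ) • (bshift q n)ᴴ) *ᵥ y = x := by
      rw [hy, Matrix.mulVec_mulVec, (RTs_mul q n α).2, Matrix.one_mulVec]
    rw [Matrix.sub_mulVec, Matrix.one_mulVec, Matrix.smul_mulVec] at this
    exact eq_add_of_sub_eq this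
  clear_value y
  have step : ∀ j : Fin (n + 1),
      (∀ h : j.val + 1 < n + 1,
        ∃ η, (fun a => y (⟨j.val + 1, h⟩, a)) = LS q t (j.val + 1) *ᵥ η) →
      ∃ η, (fun a => ((bshift q n)ᴴ *ᵥ y) (j, a)) = LS q (sShift α t) j.val *ᵥ η := by
    intro j hj
    by_cases h : j.val + 1 < n + 1
    · obtain ⟨η, hη⟩ := hj h
      obtain ⟨W, hW⟩ := c2 j.val (by omega)
      refine ⟨W *ᵥ η, ?_⟩
      rw [Matrix.mulVec_mulVec, ← hW, ← hη]
      funext a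
      rw [bshiftH_mulVec, dif_pos h]
    · refine ⟨0, ?_⟩
      funext a
      rw [bshiftH_mulVec, dif_neg h, Matrix.mulVec_zero]
      rfl
  have main : ∀ k : ℕ, ∀ j : Fin (n + 1), n ≤ j.val + k →
      ∃ η, (fun a => y (j, a)) = LS q t j.val *ᵥ η := by
    intro k
    induction k with
    | zero =>
      intro j hj
      obtain ⟨η, hη⟩ := hx j
      refine ⟨η, ?_⟩
      rw [← hη]
      funext a
      rw [hyx, Pi.add_apply, Pi.smul_apply, bshiftH_mulVec, dif_neg (by omega), smul_zero, add_zero]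
    | succ k ih =>
      intro j hj
      obtain ⟨η, hη⟩ := hx j
      obtain ⟨θ, hθ⟩ := step j (fun h => ih _ (by simp only; omega))
      obtain ⟨W, hW⟩ := c1 j.val (by omega)
      refine ⟨η + (α : ℂ) • (W *ᵥ θ), ?_⟩
      rw [Matrix.mulVec_add, Matrix.mulVec_smul, Matrix.mulVec_mulVec, ← hW, ← hη, ← hθ]
      funext a
      conv_lhs => rw [hyx]
      rfl
  rw [mem_Dsub]
  exact fun j => step j (fun h => main n _ (by simp only; omega))

lemma hank_congr {q n : ℕ} {s t : ℕ → Matrix (Fin q) (Fin q) ℂ}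
    (h : ∀ j ≤ 2 * n, t j = s j) : hank q n s = hank q n t := by
  ext p r
  simp only [hank, Matrix.of_apply]
  rw [h _ (by omega)]

lemma LS_congr {q n : ℕ} {s t : ℕ → Matrix (Fin q) (Fin q) ℂ}
    (h : ∀ j ≤ 2 * n, t j = s j) : ∀ j ≤ n, LS q s j = LS q t j := by
  intro j hj
  cases j with
  | zero => exact (h 0 (by omega)).symm
  | succ m =>
    have e1 : Zr q m s = Zr q m t := by
      ext p r
      simp only [Zr, Matrix.of_apply]
      rw [h _ (by omega)]
    have e2 : Yc q m s = Yc q m t := by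
      ext p r
      simp only [Yc, Matrix.of_apply]
      rw [h _ (by omega)]
    rw [LS_succ, LS_succ, e1, e2, h _ (by omega),
      hank_congr (n := m) (fun j hj => h j (by omega))]

lemma Dsub_congr {q n : ℕ} {s t : ℕ → Matrix (Fin q) (Fin q) ℂ}
    (h : ∀ j ≤ 2 * n, t j = s j) : Dsub q n s = Dsub q n t := by
  have : Ldiag q n s = Ldiag q n t := by
    ext p r
    simp only [Ldiag, Matrix.of_apply]
    rw [LS_congr h _ (by omega)]
  rw [Dsub, Dsub, this]

lemma all_J {q n : ℕ} {α : ℝ} {t : ℕ → Matrix (Fin q) (Fin q) ℂ}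
    (hp : (hank q (n + 1) t).PosSemidef) (hpα : (hank q n (sShift α t)).PosSemidef)
    {G Gα : Matrix (Fin (n + 1) × Fin q) (Fin (n + 1) × Fin q) ℂ}
    (hG : IsRGI (hank q n t) G (Dsub q n t))
    (hGα : IsRGI (hank q n (sShift α t)) Gα (Dsub q n (sShift α t))) (z : ℂ) :
    Theta q n α t G Gα z * Jmat q * (Theta q n α t G Gα (conj z))ᴴ = Jmat q ∧
    ThetaT q n α t G Gα z * Jmat q * (ThetaT q n α t G Gα (conj z))ᴴ = Jmat q := by
  have hp0 := hank_mono q (Nat.le_succ n) t hp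
  obtain ⟨d1, d2⟩ := D_incl hp hpα
  have ids := core_ids (α := α) hp0.1.eq (rgi_herm hp0.1.eq hG) (rgi_herm hpα.1.eq hGα)
    (hank_lyap q n α t) (rgi_fix hG fun x => d1 _ (rgi_mem hGα x))
    (rgi_fix hGα fun x => by
      rw [← Matrix.mulVec_mulVec, ← Matrix.mulVec_mulVec]
      exact d2 _ (rgi_mem hG x))
    _ _ _ _ (fun _ => rfl) (fun _ => rfl) (fun _ => rfl) (fun _ => rfl)
  obtain ⟨i11, i21, i22⟩ := ids z
  have i12 := congrArg conjTranspose (ids (conj z)).2.1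
  have hw : star (conj z - (α : ℂ)) = z - α := by simp
  have hw' : star (z - (α : ℂ)) = conj z - α := by simp
  rw [Complex.conj_conj, conjTranspose_add, conjTranspose_smul, conjTranspose_mul,
    conjTranspose_mul, conjTranspose_one, conjTranspose_conjTranspose,
    conjTranspose_conjTranspose, hw] at i12
  rw [Theta_blocks, Theta_blocks, ThetaT_blocks, ThetaT_blocks]
  constructor
  · refine J_blocks i11 ?_ ?_ ?_
    · rw [conjTranspose_neg, conjTranspose_smul, hw, Matrix.mul_neg, sub_neg_eq_add,
        Matrix.mul_smul]
      exact i12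
    · rw [Matrix.neg_mul, sub_neg_eq_add, Matrix.smul_mul]
      exact i21
    · rw [conjTranspose_neg, conjTranspose_smul, hw, Matrix.mul_neg, Matrix.neg_mul,
        Matrix.mul_smul, Matrix.smul_mul, ← neg_sub', ← smul_sub]
      rw [i22, smul_zero, neg_zero]
  · refine J_blocks ?_ ?_ ?_ ?_
    · rw [conjTranspose_smul, hw, Matrix.mul_smul, Matrix.smul_mul, ← smul_sub]
      rw [i11, smul_zero]
    · rw [conjTranspose_neg, Matrix.mul_neg, sub_neg_eq_add, Matrix.smul_mul]
      exact i12
    · rw [Matrix.neg_mul, sub_neg_eq_add, conjTranspose_smul, hw, Matrix.mul_smul]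
      exact i21
    · rw [conjTranspose_neg, Matrix.mul_neg, Matrix.neg_mul, ← neg_sub']
      rw [i22, neg_zero]

end Helpers

/-- Lemma (BLR4.3-1): `Θ_{n,α}` and `Θ̃_{n,α}` are `J̃_q`-unitary on the real axis, and their
values are invertible everywhere with `Θ⁻¹(z) = J̃_q·Θ(conj z)*·J̃_q`. -/
theorem theta_J_unitary_on_reals_and_invertible
    (q : ℕ) (hq : 1 ≤ q) (α : ℝ) (n : ℕ) (s : ℕ → Matrix (Fin q) (Fin q) ℂ)
    (hK : ∃ t : ℕ → Matrix (Fin q) (Fin q) ℂ,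
      (∀ j ≤ 2 * n + 1, t j = s j) ∧
        (hank q (n + 1) t).PosSemidef ∧ (hank q n (sShift α t)).PosSemidef)
    (G Gα : Matrix (Fin (n + 1) × Fin q) (Fin (n + 1) × Fin q) ℂ)
    (hG : IsRGI (hank q n s) G (Dsub q n s))
    (hGα : IsRGI (hank q n (sShift α s)) Gα (Dsub q n (sShift α s))) :
    (∀ x : ℝ,
      Theta q n α s G Gα (x : ℂ) * Jmat q * (Theta q n α s G Gα (x : ℂ))ᴴ = Jmat q ∧
      ThetaT q n α s G Gα (x : ℂ) * Jmat q * (ThetaT q n α s G Gα (x : ℂ))ᴴ = Jmat q) ∧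
    (∀ z : ℂ,
      IsUnit (Theta q n α s G Gα z) ∧ IsUnit (ThetaT q n α s G Gα z) ∧
      (Theta q n α s G Gα z)⁻¹ = Jmat q * (Theta q n α s G Gα (conj z))ᴴ * Jmat q ∧
      (ThetaT q n α s G Gα z)⁻¹ = Jmat q * (ThetaT q n α s G Gα (conj z))ᴴ * Jmat q) := by
  obtain ⟨t, hts, hp, hpα⟩ := hK
  have hs2 : ∀ j ≤ 2 * n, sShift α t j = sShift α s j := by
    intro j hj
    simp only [sShift]
    rw [hts j (by omega), hts (j + 1) (by omega)]
  have hs1 : ∀ j ≤ 2 * n, t j = s j := fun j hj => hts j (by omega)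
  have eH := hank_congr hs1
  rw [eH, Dsub_congr hs1] at hG
  rw [hank_congr hs2, Dsub_congr hs2] at hGα
  have eT : ∀ z, Theta q n α s G Gα z = Theta q n α t G Gα z := by
    intro z; rw [Theta, Theta, eH]
  have eTT : ∀ z, ThetaT q n α s G Gα z = ThetaT q n α t G Gα z := by
    intro z; rw [ThetaT, ThetaT, eH]
  simp only [eT, eTT]
  have key := all_J hp hpα hG hGα
  refine ⟨fun x => ?_, fun z => ?_⟩
  · have := key (x : ℂ)
    rwa [Complex.conj_ofReal] at this
  · have h1 := J_inv (key z).1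
    have h2 := J_inv (key z).2
    exact ⟨h1.1, h2.1, h1.2, h2.2⟩
end

section
/- Let q ≥ 1, α ∈ ℝ, n ∈ ℕ₀, and (s_j)_{j=0}^{2n+1} ∈ K≥,e_{α,q,2n+1}. Set M := (I − H_n^†·H_n)·R_T(α)·v_{q,n} and N := (I − H_{α▷n}^†·H_{α▷n})·H_n·v_{q,n} (both of size (n+1)q × q), and define the subspaces U_{n,α} := (ker M)^⊥ ⊆ ℂ^q and V_{n,α} := (ker N)^⊥ ⊆ ℂ^q. Then: (a) U_{n,α} and V_{n,α} are orthogonal subspaces of ℂ^q (i.e., x*y = 0 for all x ∈ U_{n,α}, y ∈ V_{n,α}), dim U_{n,α} = rank M, and dim V_{n,α} = rank N; (b) for every p ∈ ℕ and A ∈ ℂ^{q×p}: M·A = 0 if and only if P_{U_{n,α}}·A = 0, and N·A = 0 if and only if P_{V_{n,α}}·A = 0, where P_W denotes the matrix of the orthogonal projection of ℂ^q onto a subspace W. -/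
open Matrix ComplexConjugate
open scoped ComplexOrder

noncomputable section

/-- The matrix `M = (I - H_n^†·H_n)·R_T(α)·v_{q,n}`. -/
def Mmat (q n : ℕ) (α : ℝ) (s : ℕ → Matrix (Fin q) (Fin q) ℂ) :
    Matrix (Fin (n + 1) × Fin q) (Fin q) ℂ :=
  (1 - mp (hank q n s) * hank q n s) * RT q n (α : ℂ) * vq q n

/-- The matrix `N = (I - H_{α▷n}^†·H_{α▷n})·H_n·v_{q,n}`. -/
def Nmat (q n : ℕ) (α : ℝ) (s : ℕ → Matrix (Fin q) (Fin q) ℂ) :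
    Matrix (Fin (n + 1) × Fin q) (Fin q) ℂ :=
  (1 - mp (hank q n (sShift α s)) * hank q n (sShift α s)) * hank q n s * vq q n

/-- The kernel of a matrix `M : ℂ^{m×q}`, viewed as a subspace of Euclidean space `ℂ^q`. -/
def kerSub (q : ℕ) {ι : Type*} [Fintype ι] (M : Matrix ι (Fin q) ℂ) :
    Submodule ℂ (EuclideanSpace ℂ (Fin q)) :=
  LinearMap.ker
    ((Matrix.mulVecLin M).comp (WithLp.linearEquiv 2 ℂ (Fin q → ℂ)).toLinearMap)

/-- The subspace `U_{n,α} = (ker M)^⊥ ⊆ ℂ^q`. -/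
def Usub (q n : ℕ) (α : ℝ) (s : ℕ → Matrix (Fin q) (Fin q) ℂ) :
    Submodule ℂ (EuclideanSpace ℂ (Fin q)) :=
  (kerSub q (Mmat q n α s)).orthogonal

/-- The subspace `V_{n,α} = (ker N)^⊥ ⊆ ℂ^q`. -/
def Vsub (q n : ℕ) (α : ℝ) (s : ℕ → Matrix (Fin q) (Fin q) ℂ) :
    Submodule ℂ (EuclideanSpace ℂ (Fin q)) :=
  (kerSub q (Nmat q n α s)).orthogonal

end

lemma mp_spec_aux {m : Type*} [Fintype m] [DecidableEq m] (A : Matrix m m ℂ)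
    (hA : A.IsHermitian) :
    ∃ X : Matrix m m ℂ,
      A * X * A = A ∧ X * A * X = X ∧ (A * X)ᴴ = A * X ∧ (X * A)ᴴ = X * A := by
  have h := hA.spectral_theorem
  rw [Unitary.conjStarAlgAut_apply] at h
  generalize hA.eigenvectorUnitary = U0 at h
  obtain ⟨U, hU⟩ := U0
  simp only [star_eq_conjTranspose] at h
  have hU1 : Uᴴ * U = 1 := (Unitary.mem_iff.1 hU).1
  set e := hA.eigenvalues
  set D : Matrix m m ℂ := diagonal (RCLike.ofReal ∘ e) with hD
  set E : Matrix m m ℂ := diagonal (fun i => ((e i)⁻¹ : ℂ)) with hE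
  have c (X : Matrix m m ℂ) : Uᴴ * (U * X) = X := by
    rw [← Matrix.mul_assoc, hU1, Matrix.one_mul]
  have h1 : D * (E * D) = D := by
    simp only [hD, hE, diagonal_mul_diagonal]
    congr 1; ext i
    by_cases h0 : e i = 0 <;> simp [h0]
  have h2 : E * (D * E) = E := by
    simp only [hD, hE, diagonal_mul_diagonal]
    congr 1; ext i
    by_cases h0 : e i = 0 <;> simp [h0]
  have h3 : (D * E)ᴴ = D * E := by
    simp only [hD, hE, diagonal_mul_diagonal, diagonal_conjTranspose]
    congr 1; ext i
    simp
  have h4 : E * D = D * E := by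
    simp only [hD, hE, diagonal_mul_diagonal]
    congr 1; ext i
    simp [mul_comm]
  have h5 : A = U * (D * Uᴴ) := by rw [h, Matrix.mul_assoc]
  have hX1 : A * (U * (E * Uᴴ)) = U * (D * E) * Uᴴ := by
    rw [h5]; simp only [Matrix.mul_assoc, c]
  have hX2 : (U * (E * Uᴴ)) * A = U * (D * E) * Uᴴ := by
    rw [h5, ← h4]; simp only [Matrix.mul_assoc, c]
  have hX3 : (U * (D * E) * Uᴴ)ᴴ = U * (D * E) * Uᴴ := by
    rw [conjTranspose_mul, conjTranspose_mul, h3, conjTranspose_conjTranspose, ← Matrix.mul_assoc]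
  refine ⟨U * (E * Uᴴ), ?_, ?_, ?_, ?_⟩
  · rw [hX1, h5]; simp only [Matrix.mul_assoc, c]
    rw [← Matrix.mul_assoc E, ← Matrix.mul_assoc D, h1]
  · rw [hX2]; simp only [Matrix.mul_assoc, c]
    rw [← Matrix.mul_assoc D, ← h4, ← Matrix.mul_assoc (E * D), Matrix.mul_assoc E, h2]
  · rw [hX1, hX3]
  · rw [hX2, hX3]

lemma mp_spec {m : Type*} [Fintype m] [DecidableEq m] (A : Matrix m m ℂ)
    (hA : A.IsHermitian) :
    A * mp A * A = A ∧ mp A * A * mp A = mp A ∧ (A * mp A)ᴴ = A * mp A ∧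
      (mp A * A)ᴴ = mp A * A := by
  have h := mp_spec_aux A hA
  unfold mp
  rw [dif_pos h]
  exact h.choose_spec

lemma isUnit_det_aux (q n : ℕ) (z : ℂ) : IsUnit (1 - z • bshift q n).det := by
  have hb : BlockTriangular (1 - z • bshift q n)
      (fun j : Fin (n + 1) × Fin q => OrderDual.toDual j.1) := by
    intro i j hij
    have hij' : i.1 < j.1 := hij
    have h1 : i ≠ j := fun h => by simp [h] at hij'
    have h2 : ¬ (i.1.val = j.1.val + 1 ∧ i.2 = j.2) := by
      rintro ⟨h, -⟩
      have := Fin.lt_def.1 hij'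
      omega
    simp [bshift, h1, h2]
  rw [hb.det_fintype]
  have : ∀ k, ((1 - z • bshift q n).toSquareBlock
      (fun j : Fin (n + 1) × Fin q => OrderDual.toDual j.1) k) = 1 := by
    intro k
    ext ⟨i, hi⟩ ⟨j, hj⟩
    have hij : i.1 = j.1 := by
      have := hi.trans hj.symm
      exact OrderDual.toDual.injective this
    simp [toSquareBlock_def, bshift, hij, Matrix.one_apply]
  simp [this]

lemma bshift_mul_apply (q n : ℕ) (A : Matrix (Fin (n + 1) × Fin q) (Fin (n + 1) × Fin q) ℂ)
    (j k : Fin (n + 1) × Fin q) (h : j.1.val ≠ 0) :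
    (bshift q n * A) j k = A (⟨j.1.val - 1, by omega⟩, j.2) k := by
  rw [Matrix.mul_apply, Finset.sum_eq_single (⟨j.1.val - 1, by omega⟩, j.2)]
  · have : j.1.val = j.1.val - 1 + 1 := by omega
    simp [bshift, ← this]
  · rintro ⟨b1, b2⟩ - hb
    have : ¬ (j.1.val = b1.val + 1 ∧ j.2 = b2) := by
      rintro ⟨h1, h2⟩
      apply hb
      ext
      · simp [h1]
      · simp [h2]
    simp [bshift, this]
  · simp

lemma bshift_mul_apply_zero (q n : ℕ)
    (A : Matrix (Fin (n + 1) × Fin q) (Fin (n + 1) × Fin q) ℂ)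
    (j k : Fin (n + 1) × Fin q) (h : j.1.val = 0) :
    (bshift q n * A) j k = 0 := by
  rw [Matrix.mul_apply]
  apply Finset.sum_eq_zero
  intro b _
  simp [bshift, h]

lemma vq_mul (q n : ℕ) :
    vq q n * (vq q n)ᴴ = diagonal (fun j => if j.1.val = 0 then 1 else 0) := by
  ext j k
  rw [Matrix.mul_apply, diagonal_apply, Finset.sum_eq_single j.2]
  · simp only [vq, of_apply, conjTranspose_apply, Prod.ext_iff, Fin.ext_iff]
    by_cases h1 : j.1.val = 0 <;> by_cases h2 : k.1.val = 0 <;>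
      by_cases h3 : j.2.val = k.2.val <;>
      simp [h1, h2, h3, eq_comm] <;> grind
  · intro b _ hb
    simp [vq, hb.symm]
  · simp

lemma key_identity (q n : ℕ) (α : ℝ) (s : ℕ → Matrix (Fin q) (Fin q) ℂ) :
    vq q n * (vq q n)ᴴ * hank q n s = (1 - (α : ℂ) • bshift q n) * hank q n s
      - bshift q n * hank q n (sShift α s) := by
  rw [vq_mul, Matrix.sub_mul, Matrix.smul_mul]
  ext j k
  simp only [diagonal_mul, Matrix.sub_apply, Matrix.smul_apply, Matrix.one_mul]
  by_cases h : j.1.val = 0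
  · simp [bshift_mul_apply_zero, h]
  · rw [bshift_mul_apply _ _ _ _ _ h, bshift_mul_apply _ _ _ _ _ h]
    have : j.1.val - 1 + k.1.val + 1 = j.1.val + k.1.val := by omega
    simp [hank, sShift, h, this]
    ring

lemma MN_zero (q n : ℕ) (α : ℝ) (s : ℕ → Matrix (Fin q) (Fin q) ℂ)
    (hH : (hank q n s).IsHermitian) (hK : (hank q n (sShift α s)).IsHermitian) :
    Mmat q n α s * (Nmat q n α s)ᴴ = 0 := by
  obtain ⟨a1, -, -, a4⟩ := mp_spec _ hH
  obtain ⟨b1, -, -, b4⟩ := mp_spec _ hK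
  have key := key_identity q n α s
  have hR : RT q n (α : ℂ) * (1 - (α : ℂ) • bshift q n) = 1 :=
    Matrix.nonsing_inv_mul _ (isUnit_det_aux q n α)
  unfold Mmat Nmat
  set H := hank q n s
  set K := hank q n (sShift α s)
  have hPH : (1 - mp H * H) * H = 0 := by
    have : H * (1 - mp H * H) = 0 := by
      rw [Matrix.mul_sub, Matrix.mul_one, ← Matrix.mul_assoc, a1, sub_self]
    have h2 := congrArg conjTranspose this
    rwa [conjTranspose_mul, conjTranspose_sub, a4, hH.eq, conjTranspose_one,
      conjTranspose_zero] at h2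
  have hKQ : K * (1 - mp K * K) = 0 := by
    rw [Matrix.mul_sub, Matrix.mul_one, ← Matrix.mul_assoc, b1, sub_self]
  rw [conjTranspose_mul, conjTranspose_mul, conjTranspose_sub, b4, hH.eq, conjTranspose_one]
  set P := 1 - mp H * H
  set Q := 1 - mp K * K
  set R := RT q n (α : ℂ)
  have : P * R * vq q n * ((vq q n)ᴴ * (H * Q)) = P * R * (vq q n * (vq q n)ᴴ * H) * Q := by
    simp only [Matrix.mul_assoc]
  rw [this, key, Matrix.mul_sub (P * R)]
  have e1 : P * R * ((1 - (α : ℂ) • bshift q n) * H) = 0 := by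
    rw [Matrix.mul_assoc, ← Matrix.mul_assoc R, hR, Matrix.one_mul, hPH]
  rw [e1, zero_sub, Matrix.neg_mul, Matrix.mul_assoc (P * R), Matrix.mul_assoc (bshift q n), hKQ]
  simp

lemma mem_kerSub {q : ℕ} {ι : Type*} [Fintype ι] (M : Matrix ι (Fin q) ℂ)
    (x : EuclideanSpace ℂ (Fin q)) : x ∈ kerSub q M ↔ M *ᵥ x.ofLp = 0 := by
  simp [kerSub]

lemma finrank_kerSub_orth {q : ℕ} {ι : Type*} [Fintype ι] (M : Matrix ι (Fin q) ℂ) :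
    Module.finrank ℂ ↥(kerSub q M).orthogonal = M.rank := by
  apply Submodule.finrank_add_finrank_orthogonal'
  rw [add_comm]
  have := LinearMap.finrank_range_add_finrank_ker
    ((Matrix.mulVecLin M).comp (WithLp.linearEquiv 2 ℂ (Fin q → ℂ)).toLinearMap)
  rw [LinearMap.range_comp_of_range_eq_top _ (LinearEquiv.range _)] at this
  exact this

lemma mul_zero_iff {q : ℕ} {ι : Type*} [Fintype ι] (M : Matrix ι (Fin q) ℂ) (p : ℕ)
    (A : Matrix (Fin q) (Fin p) ℂ) :
    M * A = 0 ↔ ∀ j : Fin p, Submodule.orthogonalProjectionOnto (kerSub q M).orthogonal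
            ((WithLp.linearEquiv 2 ℂ (Fin q → ℂ)).symm fun i => A i j) = 0 := by
  simp only [Submodule.orthogonalProjectionOnto_eq_zero_iff, Submodule.orthogonal_orthogonal,
    mem_kerSub]
  constructor
  · intro h j
    ext i
    exact congrFun (congrFun h i) j
  · intro h
    ext i j
    exact congrFun (h j) i

lemma orth_aux {q : ℕ} {ι : Type*} [Fintype ι] (M N : Matrix ι (Fin q) ℂ)
    (h : M * Nᴴ = 0) : (kerSub q N).orthogonal ≤ kerSub q M := by
  let W : Submodule ℂ (EuclideanSpace ℂ (Fin q)) := LinearMap.range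
    ((WithLp.linearEquiv 2 ℂ (Fin q → ℂ)).symm.toLinearMap.comp (Matrix.mulVecLin Nᴴ))
  have h1 : W.orthogonal ≤ kerSub q N := by
    intro z hz
    rw [mem_kerSub, ← dotProduct_star_self_eq_zero]
    have := (Submodule.mem_orthogonal _ _).1 hz _ ⟨N *ᵥ z.ofLp, rfl⟩
    simp [EuclideanSpace.inner_eq_star_dotProduct] at this
    rw [star_mulVec, conjTranspose_mul, conjTranspose_conjTranspose, dotProduct_comm,
      ← dotProduct_mulVec] at this
    rw [star_mulVec, ← dotProduct_mulVec, mulVec_mulVec]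
    exact this
  have h2 : W ≤ kerSub q M := by
    rintro _ ⟨x, rfl⟩
    rw [mem_kerSub]
    simp [h]
  calc (kerSub q N).orthogonal ≤ W.orthogonal.orthogonal := Submodule.orthogonal_le h1
    _ = W := Submodule.orthogonal_orthogonal W
    _ ≤ _ := h2

/-- Lemma (170): the subspaces `U_{n,α} = (ker M)^⊥` and `V_{n,α} = (ker N)^⊥` are
orthogonal, their dimensions are the ranks of `M` and `N`, and `M·A = 0` (resp. `N·A = 0`)
holds iff the orthogonal projection onto `U_{n,α}` (resp. `V_{n,α}`) annihilates all columns
of `A`. -/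
theorem orthogonal_parameter_subspaces
    (q : ℕ) (hq : 1 ≤ q) (α : ℝ) (n : ℕ) (s : ℕ → Matrix (Fin q) (Fin q) ℂ)
    (hK : ∃ t : ℕ → Matrix (Fin q) (Fin q) ℂ,
      (∀ j ≤ 2 * n + 1, t j = s j) ∧
        (hank q (n + 1) t).PosSemidef ∧ (hank q n (sShift α t)).PosSemidef) :
    ((∀ x ∈ Usub q n α s, ∀ y ∈ Vsub q n α s, (inner ℂ x y : ℂ) = 0) ∧
      Module.finrank ℂ ↥(Usub q n α s) = (Mmat q n α s).rank ∧
      Module.finrank ℂ ↥(Vsub q n α s) = (Nmat q n α s).rank) ∧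
    (∀ (p : ℕ) (A : Matrix (Fin q) (Fin p) ℂ),
      (Mmat q n α s * A = 0 ↔
        ∀ j : Fin p, Submodule.orthogonalProjectionOnto (Usub q n α s)
            ((WithLp.linearEquiv 2 ℂ (Fin q → ℂ)).symm fun i => A i j) = 0) ∧
      (Nmat q n α s * A = 0 ↔
        ∀ j : Fin p, Submodule.orthogonalProjectionOnto (Vsub q n α s)
            ((WithLp.linearEquiv 2 ℂ (Fin q → ℂ)).symm fun i => A i j) = 0)) := by
  obtain ⟨t, hts, hH, hK⟩ := hK
  have hH' : (hank q n s).IsHermitian := by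
    ext j k
    have := congrFun (congrFun hH.1.eq (j.1.castSucc, j.2)) (k.1.castSucc, k.2)
    simp only [hank, conjTranspose_apply, of_apply, Fin.val_castSucc] at this ⊢
    rwa [hts _ (by omega), hts _ (by omega)] at this
  have hKe : hank q n (sShift α t) = hank q n (sShift α s) := by
    ext j k
    simp only [hank, sShift, of_apply]
    rw [hts _ (by omega), hts _ (by omega)]
  rw [hKe] at hK
  have h0 := MN_zero q n α s hH' hK.1
  refine ⟨⟨?_, finrank_kerSub_orth _, finrank_kerSub_orth _⟩,
    fun p A => ⟨mul_zero_iff _ p A, mul_zero_iff _ p A⟩⟩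
  intro x hx y hy
  exact (Submodule.mem_orthogonal' _ _).1 hx y (orth_aux _ _ h0 hy)
end

section
/- Let q ≥ 1, let A and B be Hermitian complex q×q matrices, let T ∈ ℂ^{q×q}, and let U and V be subspaces of ℂ^q such that ker A ∩ U = {0}, ker A + U = ℂ^q, ker B ∩ V = {0}, ker B + V = ℂ^q, and T*(U) ⊆ V ⊆ U. Let X ∈ ℂ^{q×q} satisfy AXA = A, XAX = X, range X = U, ker X = U^⊥, and let Y ∈ ℂ^{q×q} satisfy BYB = B, YBY = Y, range Y = V, ker Y = V^⊥. Then for every ℓ ∈ ℕ₀: X·T^ℓ·(I_q − A·X) = 0 and Y·T^ℓ·(I_q − A·X) = 0; and for every integer k ≥ 1: X·T^k·(I_q − B·Y) = 0 and Y·T^k·(I_q − B·Y) = 0. -/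
open Matrix

/-- Lemma (A.46): for Hermitian `A`, `B` with generalized inverses `X = A_U^⊐`, `Y = B_V^⊐`
associated with subspaces `U`, `V` satisfying `T*(U) ⊆ V ⊆ U`, one has
`X·Tˡ·(I - AX) = 0` and `Y·Tˡ·(I - AX) = 0` for all `ℓ ≥ 0`, and
`X·Tᵏ·(I - BY) = 0` and `Y·Tᵏ·(I - BY) = 0` for all `k ≥ 1`. -/
theorem generalized_inverse_invariant_subspace_annihilation
    (q : ℕ) (hq : 1 ≤ q)
    (A B T : Matrix (Fin q) (Fin q) ℂ) (hA : Aᴴ = A) (hB : Bᴴ = B)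
    (U V : Submodule ℂ (Fin q → ℂ))
    (hAU₁ : LinearMap.ker (Matrix.mulVecLin A) ⊓ U = ⊥)
    (hAU₂ : LinearMap.ker (Matrix.mulVecLin A) ⊔ U = ⊤)
    (hBV₁ : LinearMap.ker (Matrix.mulVecLin B) ⊓ V = ⊥)
    (hBV₂ : LinearMap.ker (Matrix.mulVecLin B) ⊔ V = ⊤)
    (hTU : Submodule.map (Matrix.mulVecLin Tᴴ) U ≤ V) (hVU : V ≤ U)
    (X : Matrix (Fin q) (Fin q) ℂ)
    (hX₁ : A * X * A = A) (hX₂ : X * A * X = X)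
    (hX₃ : LinearMap.range (Matrix.mulVecLin X) = U)
    (hX₄ : ∀ x : Fin q → ℂ, X.mulVec x = 0 ↔ ∀ y ∈ U, dotProduct (star y) x = 0)
    (Y : Matrix (Fin q) (Fin q) ℂ)
    (hY₁ : B * Y * B = B) (hY₂ : Y * B * Y = Y)
    (hY₃ : LinearMap.range (Matrix.mulVecLin Y) = V)
    (hY₄ : ∀ x : Fin q → ℂ, Y.mulVec x = 0 ↔ ∀ y ∈ V, dotProduct (star y) x = 0) :
    (∀ ℓ : ℕ, X * T ^ ℓ * (1 - A * X) = 0 ∧ Y * T ^ ℓ * (1 - A * X) = 0) ∧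
    (∀ k : ℕ, 1 ≤ k → X * T ^ k * (1 - B * Y) = 0 ∧ Y * T ^ k * (1 - B * Y) = 0) := by
  have key : ∀ x : Fin q → ℂ, Y *ᵥ x = 0 → X *ᵥ (T *ᵥ x) = 0 := by
    intro x hx
    rw [hX₄]
    intro y hy
    have h1 : Tᴴ *ᵥ y ∈ V := hTU ⟨y, hy, rfl⟩
    have h2 := (hY₄ x).1 hx _ h1
    rw [Matrix.star_mulVec, Matrix.conjTranspose_conjTranspose] at h2
    rw [Matrix.dotProduct_mulVec]
    exact h2
  have hXY : ∀ x : Fin q → ℂ, X *ᵥ x = 0 → Y *ᵥ x = 0 := fun x hx =>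
    (hY₄ x).2 fun y hy => (hX₄ x).1 hx y (hVU hy)
  have hpow : ∀ (n : ℕ) (x : Fin q → ℂ), X *ᵥ x = 0 → X *ᵥ ((T ^ n) *ᵥ x) = 0 := by
    intro n
    induction n with
    | zero => intro x hx; simpa using hx
    | succ n ih =>
      intro x hx
      rw [pow_succ, ← Matrix.mulVec_mulVec]
      exact ih _ (key x (hXY x hx))
  have hpowY : ∀ (n : ℕ), 1 ≤ n → ∀ (x : Fin q → ℂ), Y *ᵥ x = 0 →
      X *ᵥ ((T ^ n) *ᵥ x) = 0 := by
    intro n hn x hx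
    obtain ⟨m, rfl⟩ := Nat.exists_eq_add_of_le' hn
    rw [pow_succ, ← Matrix.mulVec_mulVec]
    exact hpow m _ (key x hx)
  have hXk : ∀ v : Fin q → ℂ, X *ᵥ ((1 - A * X) *ᵥ v) = 0 := by
    intro v
    rw [Matrix.mulVec_mulVec, mul_sub, ← mul_assoc, hX₂, mul_one, sub_self, Matrix.zero_mulVec]
  have hYk : ∀ v : Fin q → ℂ, Y *ᵥ ((1 - B * Y) *ᵥ v) = 0 := by
    intro v
    rw [Matrix.mulVec_mulVec, mul_sub, ← mul_assoc, hY₂, mul_one, sub_self, Matrix.zero_mulVec]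
  have lift : ∀ P Q R : Matrix (Fin q) (Fin q) ℂ,
      (∀ v, P *ᵥ (Q *ᵥ (R *ᵥ v)) = 0) → P * Q * R = 0 := by
    intro P Q R h
    apply Matrix.mulVec_injective
    funext v
    rw [← Matrix.mulVec_mulVec, ← Matrix.mulVec_mulVec, h v, Matrix.zero_mulVec]
  exact ⟨fun l => ⟨lift _ _ _ fun v => hpow l _ (hXk v),
      lift _ _ _ fun v => hXY _ (hpow l _ (hXk v))⟩,
    fun k hk => ⟨lift _ _ _ fun v => hpowY k hk _ (hYk v),
      lift _ _ _ fun v => hXY _ (hpowY k hk _ (hYk v))⟩⟩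
end
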